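/- arXiv:2510.15169 — 2 statements merged into one kernel-verified Lean document; each statement's English description precedes it below -/
import Mathlib

section
/- Let n ≥ 3. Then W^{inc}({1,…,n}) = W^{inc}({2,…,n}) ∪ { u∘w₀ : u ∈ W^{inc}({2,…,n}) }, where W^{inc}({2,…,n}) consists of permutations of {1,…,n} fixing 1, and w₀ is the longest element of S_n. -/
/-- The positive root `α_{i,j} = e_i − e_j` of type `A_{n−1}` as a vector (1-based indices). -/
noncomputable def rootR (i j : ℕ) : ℕ → ℝ := fun k => (if k = i then 1 else 0) - (if k = j then 1 else 0)

/-- The longest element of the symmetric group on the interval `{a, …, b}`,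
viewed as a permutation of `ℕ` fixing everything else. -/
def wLong (a b : ℕ) : Equiv.Perm ℕ :=
  Function.Involutive.toPerm (fun k => if a ≤ k ∧ k ≤ b then a + b - k else k)
    (by intro k; dsimp only; split_ifs <;> omega)

/-- `|w(α_i)|`: whichever of `±(e_{w(i)} − e_{w(i+1)})` is a positive root. -/
noncomputable def absRoot (w : Equiv.Perm ℕ) (i : ℕ) : ℕ → ℝ :=
  rootR (min (w i) (w (i + 1))) (max (w i) (w (i + 1)))

/-- Permutations of `{a, …, b}`: permutations of `ℕ` fixing every element outside `[a,b]`. -/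
def SB (a b : ℕ) : Set (Equiv.Perm ℕ) := {w | ∀ k ∉ Finset.Icc a b, w k = k}

/-- The cone generated by the positive roots `|w(α_i)|`, `a ≤ i ≤ b − 1`. -/
noncomputable def ConeB (a b : ℕ) (w : Equiv.Perm ℕ) : Set (ℕ → ℝ) :=
  {v | ∃ c : ℕ → ℝ, (∀ i ∈ Finset.Icc a (b - 1), 0 ≤ c i) ∧
      v = ∑ i ∈ Finset.Icc a (b - 1), c i • absRoot w i}

/-- Vectors `Σ_{i=a}^{b−1} c_i α_i` with `c_a > c_{a+1} > ⋯ > c_{b−1} > 0`. -/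
def decSet (a b : ℕ) : Set (ℕ → ℝ) :=
  {v | ∃ c : ℕ → ℝ, (∀ i, a ≤ i → i + 1 ≤ b - 1 → c (i + 1) < c i) ∧ 0 < c (b - 1) ∧
      v = ∑ i ∈ Finset.Icc a (b - 1), c i • rootR i (i + 1)}

/-- Vectors `Σ_{i=a}^{b−1} c_i α_i` with `0 < c_a < c_{a+1} < ⋯ < c_{b−1}`. -/
def incSet (a b : ℕ) : Set (ℕ → ℝ) :=
  {v | ∃ c : ℕ → ℝ, 0 < c a ∧ (∀ i, a ≤ i → i + 1 ≤ b - 1 → c i < c (i + 1)) ∧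
      v = ∑ i ∈ Finset.Icc a (b - 1), c i • rootR i (i + 1)}

def Wdec (a b : ℕ) : Set (Equiv.Perm ℕ) := {w | w ∈ SB a b ∧ decSet a b ⊆ ConeB a b w}

def Winc (a b : ℕ) : Set (Equiv.Perm ℕ) := {w | w ∈ SB a b ∧ incSet a b ⊆ ConeB a b w}

/-- The chamber `C_m ⊆ ℝ^n`. -/
def Cm (n m : ℕ) : Set (ℕ → ℝ) :=
  {v | ∃ a : ℕ → ℝ,
    (∀ i, 1 ≤ i → i + 1 ≤ n - m → a (i + 1) < a i) ∧
    (∀ i, n - m ≤ i → i + 1 ≤ n - 1 → a i < a (i + 1)) ∧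
    0 < a (n - m) ∧
    v = ∑ i ∈ Finset.Icc 1 (n - 1), a i • rootR i (i + 1)}

/-- `W^m`: permutations of `{1,…,n}` whose cone contains `C_m`. -/
def Wm (n m : ℕ) : Set (Equiv.Perm ℕ) := {w | w ∈ SB 1 n ∧ Cm n m ⊆ ConeB 1 n w}

noncomputable def wiSgn (w : Equiv.Perm ℕ) (i : ℕ) : ℝ := if w i < w (i+1) then 1 else -1

lemma wi_absRoot (w : Equiv.Perm ℕ) (i : ℕ) :
    absRoot w i = wiSgn w i • rootR (w i) (w (i+1)) := by
  unfold absRoot wiSgn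
  split_ifs with h
  · rw [min_eq_left h.le, max_eq_right h.le, one_smul]
  · rw [not_lt] at h
    rw [min_eq_right h, max_eq_left h]
    ext k
    simp [rootR]

lemma wi_coord (w : Equiv.Perm ℕ) (a b : ℕ) (hab : a < b) (D : ℕ → ℝ) (j : ℕ) :
    (∑ i ∈ Finset.Icc a (b-1), D i • rootR (w i) (w (i+1))) (w j) =
      (if a ≤ j ∧ j < b then D j else 0) - (if a < j ∧ j ≤ b then D (j-1) else 0) := by
  rw [Finset.sum_apply]
  simp only [Pi.smul_apply, rootR, smul_eq_mul, mul_sub, Finset.sum_sub_distrib,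
    EmbeddingLike.apply_eq_iff_eq, mul_ite, mul_one, mul_zero]
  congr 1
  · rw [Finset.sum_ite_eq]
    have : j ∈ Finset.Icc a (b-1) ↔ a ≤ j ∧ j < b := by rw [Finset.mem_Icc]; omega
    simp only [this]
  · by_cases h : a < j ∧ j ≤ b
    · rw [if_pos h, Finset.sum_eq_single (j-1)]
      · rw [if_pos (by omega)]
      · intro i _ hi; rw [if_neg (by omega)]
      · intro hh; exact absurd (Finset.mem_Icc.2 (by omega)) hh
    · rw [if_neg h]
      apply Finset.sum_eq_zero
      intro i hi
      rw [Finset.mem_Icc] at hi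
      rw [if_neg (by omega)]

/-- partial sums recover the coefficients -/
lemma wi_psum (w : Equiv.Perm ℕ) (a b : ℕ) (hab : a < b) (D v : ℕ → ℝ)
    (hv : v = ∑ i ∈ Finset.Icc a (b-1), D i • rootR (w i) (w (i+1))) (i : ℕ) (hi : a ≤ i)
    (hib : i ≤ b) : ∑ j ∈ Finset.Icc a i, v (w j) = if i < b then D i else 0 := by
  induction i, hi using Nat.le_induction with
  | base => rw [Finset.Icc_self, Finset.sum_singleton, hv, wi_coord w a b hab]; simp
  | succ i hi ih =>
    rw [Finset.sum_Icc_succ_top (by omega), add_comm, ih (by omega), hv,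
      wi_coord w a b hab, if_pos (show i < b by omega), if_pos (show a < i+1 ∧ i+1 ≤ b by omega)]
    by_cases h : i + 1 < b
    · rw [if_pos (by omega), if_pos h]; simp
    · rw [if_neg (by omega), if_neg h]; simp

lemma wi_maps {a b : ℕ} {w : Equiv.Perm ℕ} (hw : w ∈ SB a b) (j : ℕ) :
    (a ≤ w j ∧ w j ≤ b) ↔ (a ≤ j ∧ j ≤ b) := by
  constructor
  · intro h
    by_contra hj
    have := hw j (by simpa using hj)
    rw [this] at h; exact hj h
  · intro h
    by_contra hj
    have := hw (w j) (by simpa using hj)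
    have := w.injective this
    rw [this] at hj; exact hj h

lemma wi_tot {a b : ℕ} {w : Equiv.Perm ℕ} (hw : w ∈ SB a b) (v : ℕ → ℝ) :
    ∑ j ∈ Finset.Icc a b, v (w j) = ∑ j ∈ Finset.Icc a b, v j := by
  apply Finset.sum_bijective w w.bijective
  · intro i; rw [Finset.mem_Icc, Finset.mem_Icc]; exact (wi_maps hw i).symm
  · intros; rfl

lemma wi_inc (a b : ℕ) (hab : a < b) (v : ℕ → ℝ) (hv : v ∈ incSet a b) :
    (∀ j, a ≤ j → j < b → 0 < v j) ∧ (∀ j, ¬ (a ≤ j ∧ j ≤ b) → v j = 0) ∧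
      ∑ j ∈ Finset.Icc a b, v j = 0 := by
  obtain ⟨c, h0, hc, rfl⟩ := hv
  have key := wi_coord 1 a b hab c
  simp only [Equiv.Perm.coe_one, id_eq] at key
  refine ⟨fun j h1 h2 => ?_, fun j h => ?_, ?_⟩
  · rw [key, if_pos ⟨h1, h2⟩]
    by_cases h : a < j
    · rw [if_pos (by omega)]
      have := hc (j-1) (by omega) (by omega)
      rw [Nat.sub_add_cancel (by omega)] at this
      linarith
    · have : j = a := by omega
      subst this
      simpa using h0
  · rw [key, if_neg (by omega), if_neg (by omega)]; simp
  · have := wi_psum 1 a b hab c _ rfl b hab.le le_rfl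
    simpa using this

def WiP (a b : ℕ) (w : Equiv.Perm ℕ) : Prop :=
  w ∈ SB a b ∧ ∀ i, a ≤ i → i < b → (w i < w (i+1) ↔ i < w⁻¹ b)

lemma wi_pos (a b : ℕ) (hab : a < b) (w : Equiv.Perm ℕ) (hw : w ∈ SB a b) (v : ℕ → ℝ)
    (hv : v ∈ incSet a b) (i : ℕ) (hi : a ≤ i) (hib : i < b) :
    (i < w⁻¹ b → 0 < ∑ j ∈ Finset.Icc a i, v (w j)) ∧
    (¬ i < w⁻¹ b → ∑ j ∈ Finset.Icc a i, v (w j) < 0) := by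
  obtain ⟨hp, -, ht⟩ := wi_inc a b hab v hv
  have hne : ∀ j, j ≠ w⁻¹ b → w j ≠ b := by
    rintro j hj rfl; simp at hj
  constructor
  · intro h
    apply Finset.sum_pos
    · intro j hj
      rw [Finset.mem_Icc] at hj
      have h1 := (wi_maps hw j).2 (by omega)
      have h2 := hne j (by omega)
      exact hp _ h1.1 (by omega)
    · exact ⟨a, by simpa using hi⟩
  · intro h
    rw [← wi_tot hw v] at ht
    have hsplit : ∑ j ∈ Finset.Icc a b, v (w j) =
        ∑ j ∈ Finset.Icc a i, v (w j) + ∑ j ∈ Finset.Ioc i b, v (w j) := by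
      rw [← Finset.sum_union]
      · congr 1; ext x; simp only [Finset.mem_union, Finset.mem_Icc, Finset.mem_Ioc]; omega
      · rw [Finset.disjoint_left]; intro x; simp only [Finset.mem_Icc, Finset.mem_Ioc]; omega
    have : 0 < ∑ j ∈ Finset.Ioc i b, v (w j) := by
      apply Finset.sum_pos
      · intro j hj
        rw [Finset.mem_Ioc] at hj
        have h1 := (wi_maps hw j).2 (by omega)
        have h2 := hne j (by omega)
        exact hp _ h1.1 (by omega)
      · exact ⟨b, by simpa using hib⟩
    linarith

lemma wi_iff (a b : ℕ) (hab : a < b) (w : Equiv.Perm ℕ) : w ∈ Winc a b ↔ WiP a b w := by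
  constructor
  · rintro ⟨hw, hsub⟩
    refine ⟨hw, fun i hi hib => ?_⟩
    have hv : (∑ i ∈ Finset.Icc a (b-1), ((i:ℝ) - a + 1) • rootR i (i+1)) ∈ incSet a b :=
      ⟨fun i => (i:ℝ) - a + 1, by simp, by intro i _ _; push_cast; linarith, rfl⟩
    obtain ⟨d, hd, hvd⟩ := hsub hv
    obtain ⟨h1, h2⟩ := wi_pos a b hab w hw _ hv i hi hib
    have := wi_psum w a b hab (fun i => d i * wiSgn w i) _
      (by refine hvd.trans ?_; simp only [wi_absRoot, smul_smul]) i hi hib.le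
    rw [this, if_pos hib] at h1 h2
    have hdi := hd i (Finset.mem_Icc.2 (by omega))
    unfold wiSgn at h1 h2
    constructor
    · intro h; by_contra h'
      have := h2 h'; rw [if_pos h] at this; linarith
    · intro h; by_contra h'
      have := h1 h; rw [if_neg h'] at this; linarith
  · rintro ⟨hw, hP⟩
    refine ⟨hw, fun v hv => ?_⟩
    refine ⟨fun i => wiSgn w i * ∑ j ∈ Finset.Icc a i, v (w j), ?_, ?_⟩
    · intro i hi
      rw [Finset.mem_Icc] at hi
      obtain ⟨h1, h2⟩ := wi_pos a b hab w hw _ hv i hi.1 (by omega)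
      have := hP i hi.1 (by omega)
      dsimp only
      unfold wiSgn
      split_ifs with h
      · have := h1 (this.1 h); linarith
      · have := h2 (fun h' => h (this.2 h')); linarith
    · have hs : ∀ i, wiSgn w i * wiSgn w i = 1 := by
        intro i; unfold wiSgn; split_ifs <;> norm_num
      have hs2 : ∀ i, (wiSgn w i * ∑ j ∈ Finset.Icc a i, v (w j)) • absRoot w i =
          (∑ j ∈ Finset.Icc a i, v (w j)) • rootR (w i) (w (i+1)) := by
        intro i; rw [wi_absRoot, smul_smul, mul_right_comm, hs, one_mul]
      simp only [hs2]
      obtain ⟨-, hz, ht⟩ := wi_inc a b hab v hv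
      rw [← wi_tot hw v] at ht
      ext k
      obtain ⟨j, rfl⟩ := w.surjective k
      rw [wi_coord w a b hab (fun i => ∑ j ∈ Finset.Icc a i, v (w j))]
      have hsucc : ∀ j, a < j → ∑ x ∈ Finset.Icc a j, v (w x) =
          v (w j) + ∑ x ∈ Finset.Icc a (j-1), v (w x) := by
        intro j hj
        obtain ⟨m, rfl⟩ : ∃ m, j = m + 1 := ⟨j-1, by omega⟩
        rw [Finset.sum_Icc_succ_top (by omega), add_comm]
        simp
      by_cases h : a ≤ j ∧ j ≤ b
      · by_cases h1 : j = b
        · subst h1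
          rw [if_neg (by omega), if_pos (by omega)]
          rw [hsucc j hab] at ht
          linarith
        · rw [if_pos (by omega)]
          by_cases h2 : a < j
          · rw [if_pos (by omega), hsucc j h2]; ring
          · have : j = a := by omega
            subst this
            simp
      · rw [if_neg (by omega), if_neg (by omega), hz _ (by rw [wi_maps hw]; exact h)]; simp

lemma wi_inv_mem {a b : ℕ} {w : Equiv.Perm ℕ} (hw : w ∈ SB a b) (k : ℕ) (hk : a ≤ k ∧ k ≤ b) :
    a ≤ w⁻¹ k ∧ w⁻¹ k ≤ b := by
  rw [← wi_maps hw]; simpa using hk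

lemma wi_long (n k : ℕ) : wLong 1 n k = if 1 ≤ k ∧ k ≤ n then 1 + n - k else k := rfl

lemma wi_long_sq (n : ℕ) : wLong 1 n * wLong 1 n = 1 := by
  ext k
  simp only [Equiv.Perm.mul_apply, wi_long, Equiv.Perm.coe_one, id_eq]
  split_ifs <;> omega

lemma wi_long_P (n : ℕ) (hn : 3 ≤ n) (w : Equiv.Perm ℕ) (h : WiP 1 n w) :
    WiP 1 n (w * wLong 1 n) := by
  obtain ⟨hw, hP⟩ := h
  refine ⟨?_, fun i hi hin => ?_⟩
  · intro k hk
    have := hw k hk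
    rw [Finset.mem_Icc] at hk
    rw [Equiv.Perm.mul_apply, wi_long, if_neg hk, this]
  · have hinv : (wLong 1 n)⁻¹ = wLong 1 n := inv_eq_of_mul_eq_one_left (wi_long_sq n)
    have hp := wi_inv_mem hw n (by omega)
    rw [mul_inv_rev, hinv]
    simp only [Equiv.Perm.mul_apply]
    rw [wi_long n i, wi_long n (i+1), wi_long n (w⁻¹ n), if_pos (by omega), if_pos (by omega),
      if_pos hp]
    have h1 := hP (n - i) (by omega) (by omega)
    have h2 : w (n - i + 1) ≠ w (n - i) := by
      intro h; have := w.injective h; omega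
    rw [show 1 + n - i = n - i + 1 by omega, show 1 + n - (i + 1) = n - i by omega]
    omega

lemma wi_two (n : ℕ) (hn : 3 ≤ n) (w : Equiv.Perm ℕ) : WiP 2 n w ↔ WiP 1 n w ∧ w 1 = 1 := by
  constructor
  · rintro ⟨hw, hP⟩
    have h1 : w 1 = 1 := hw 1 (by simp)
    refine ⟨⟨?_, ?_⟩, h1⟩
    · intro k hk
      apply hw
      rw [Finset.mem_Icc] at *; omega
    · intro i hi hin
      by_cases h : i = 1
      · subst h
        have h2 := (wi_maps hw 2).2 (by omega)
        have h3 := wi_inv_mem hw n (by omega)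
        rw [h1]
        exact ⟨fun _ => by omega, fun _ => by change 1 < w 2; omega⟩
      · exact hP i (by omega) hin
  · rintro ⟨⟨hw, hP⟩, h1⟩
    refine ⟨?_, fun i hi => hP i (by omega)⟩
    intro k hk
    by_cases h : k = 1
    · rw [h, h1]
    · apply hw
      rw [Finset.mem_Icc] at *; omega

lemma wi_end (n : ℕ) (hn : 3 ≤ n) (w : Equiv.Perm ℕ) (h : WiP 1 n w) : w 1 = 1 ∨ w n = 1 := by
  obtain ⟨hw, hP⟩ := h
  have hq := wi_inv_mem hw 1 (by omega)
  have hwq : w (w⁻¹ 1) = 1 := by simp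
  generalize w⁻¹ 1 = q at hq hwq
  by_cases h1 : q = 1
  · left; rw [← h1, hwq, h1]
  by_cases h2 : q = n
  · right; rw [← h2, hwq]
  exfalso
  by_cases h3 : q < w⁻¹ n
  · have := (hP (q-1) (by omega) (by omega)).2 (by omega)
    rw [Nat.sub_add_cancel (by omega), hwq] at this
    have := (wi_maps hw (q-1)).2 (by omega)
    omega
  · have h4 := (hP q (by omega) (by omega)).not.2 h3
    have h5 := (wi_maps hw (q+1)).2 (by omega)
    have h6 : w (q+1) ≠ w q := by
      intro h; have := w.injective h; omega
    omega

theorem Winc_inductive_description (n : ℕ) (hn : 3 ≤ n) :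
    Winc 1 n = Winc 2 n ∪ (fun u => u * wLong 1 n) '' Winc 2 n := by
  ext w
  simp only [Set.mem_union, Set.mem_image, wi_iff 1 n (by omega), wi_iff 2 n (by omega)]
  constructor
  · intro h
    rcases wi_end n hn w h with h1 | h1
    · left; exact (wi_two n hn w).2 ⟨h, h1⟩
    · right
      refine ⟨w * wLong 1 n, (wi_two n hn _).2 ⟨wi_long_P n hn w h, ?_⟩, ?_⟩
      · rw [Equiv.Perm.mul_apply, wi_long, if_pos (by omega), Nat.add_sub_cancel_left, h1]
      · rw [mul_assoc, wi_long_sq, mul_one]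
  · rintro (h | ⟨u, hu, rfl⟩)
    · exact ((wi_two n hn w).1 h).1
    · exact wi_long_P n hn u ((wi_two n hn u).1 hu).1
end

section
/- Let n ≥ 4 and 1 < m < n−1. Then W^m = E ∪ { x∘w₀ : x ∈ E }, where E := { u∘v : u ∈ W^{dec}({1,…,n−m}), v ∈ W^{inc}({n−m+1,…,n}) } and w₀ is the longest element of S_n. -/
lemma rootR_self (i : ℕ) : rootR i i = 0 := by
  funext k; simp [rootR]

lemma rootR_add (i j k : ℕ) : rootR i j + rootR j k = rootR i k := by
  funext x; simp [rootR]

lemma cone_zero (a b : ℕ) (w : Equiv.Perm ℕ) : (0 : ℕ → ℝ) ∈ ConeB a b w :=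
  ⟨fun _ => 0, fun _ _ => le_refl _, by simp⟩

lemma cone_add {a b : ℕ} {w : Equiv.Perm ℕ} {x y : ℕ → ℝ} (hx : x ∈ ConeB a b w)
    (hy : y ∈ ConeB a b w) : x + y ∈ ConeB a b w := by
  obtain ⟨c, hc, rfl⟩ := hx
  obtain ⟨d, hd, rfl⟩ := hy
  refine ⟨fun i => c i + d i, fun i hi => add_nonneg (hc i hi) (hd i hi), ?_⟩
  rw [← Finset.sum_add_distrib]
  exact Finset.sum_congr rfl fun i _ => (add_smul _ _ _).symm

lemma cone_smul {a b : ℕ} {w : Equiv.Perm ℕ} {x : ℕ → ℝ} {r : ℝ} (hr : 0 ≤ r)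
    (hx : x ∈ ConeB a b w) : r • x ∈ ConeB a b w := by
  obtain ⟨c, hc, rfl⟩ := hx
  refine ⟨fun i => r * c i, fun i hi => mul_nonneg hr (hc i hi), ?_⟩
  rw [Finset.smul_sum]
  exact Finset.sum_congr rfl fun i _ => (mul_smul _ _ _).symm

lemma cone_sum {a b : ℕ} {w : Equiv.Perm ℕ} (s : Finset ℕ) (f : ℕ → ℕ → ℝ)
    (h : ∀ i ∈ s, f i ∈ ConeB a b w) : ∑ i ∈ s, f i ∈ ConeB a b w := by
  induction s using Finset.induction_on with
  | empty => simpa using cone_zero a b w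
  | insert i s hi ih =>
    rw [Finset.sum_insert hi]
    exact cone_add (h i (by simp)) (ih fun j hj => h j (by simp [hj]))

lemma cone_gen {a b : ℕ} {w : Equiv.Perm ℕ} {i : ℕ} (hi : a ≤ i) (hi2 : i < b) :
    absRoot w i ∈ ConeB a b w := by
  refine ⟨fun j => if j = i then 1 else 0, fun j _ => by dsimp only; split_ifs <;> norm_num, ?_⟩
  have : i ∈ Finset.Icc a (b - 1) := by simp; omega
  simp only [ite_smul, one_smul, zero_smul, Finset.sum_ite_eq', this, if_true]

/-- monotone path between the entries `k` and `l` -/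
def Mon (w : Equiv.Perm ℕ) (k l : ℕ) : Prop :=
  ∀ i, (w.symm k ≤ i → i < w.symm l → w i < w (i + 1)) ∧
    (w.symm l ≤ i → i < w.symm k → w (i + 1) < w i)

lemma path_asc {a b : ℕ} {w : Equiv.Perm ℕ} {s t : ℕ} (has : a ≤ s) (hst : s ≤ t) :
    t ≤ b → (∀ i, s ≤ i → i < t → w i < w (i + 1)) → rootR (w s) (w t) ∈ ConeB a b w := by
  induction t, hst using Nat.le_induction with
  | base => intro _ _; rw [rootR_self]; exact cone_zero _ _ _
  | succ t hst ih =>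
    intro htb h
    rw [← rootR_add _ (w t)]
    refine cone_add (ih (by omega) fun i h1 h2 => h i h1 (by omega)) ?_
    have h1 := h t hst (by omega)
    have h2 : absRoot w t ∈ ConeB a b w := cone_gen (by omega) (by omega)
    rwa [absRoot, min_eq_left h1.le, max_eq_right h1.le] at h2

lemma path_desc {a b : ℕ} {w : Equiv.Perm ℕ} {s t : ℕ} (has : a ≤ s) (hst : s ≤ t) :
    t ≤ b → (∀ i, s ≤ i → i < t → w (i + 1) < w i) → rootR (w t) (w s) ∈ ConeB a b w := by
  induction t, hst using Nat.le_induction with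
  | base => intro _ _; rw [rootR_self]; exact cone_zero _ _ _
  | succ t hst ih =>
    intro htb h
    rw [← rootR_add _ (w t)]
    refine cone_add ?_ (ih (by omega) fun i h1 h2 => h i h1 (by omega))
    have h1 := h t hst (by omega)
    have h2 : absRoot w t ∈ ConeB a b w := cone_gen (by omega) (by omega)
    rwa [absRoot, min_eq_right h1.le, max_eq_left h1.le] at h2

lemma SB_mem {a b : ℕ} {w : Equiv.Perm ℕ} (hw : w ∈ SB a b) {k : ℕ} :
    (a ≤ w k ∧ w k ≤ b) ↔ (a ≤ k ∧ k ≤ b) := by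
  have key : ∀ k, (k ∉ Finset.Icc a b → w k = k) := hw
  simp only [Finset.mem_Icc] at key
  constructor
  · intro h
    by_contra hk
    rw [key k hk] at h
    exact hk h
  · intro h
    by_contra hk
    have := w.injective (key _ hk)
    rw [this] at hk
    exact hk h

lemma SB_symm_mem {a b : ℕ} {w : Equiv.Perm ℕ} (hw : w ∈ SB a b) {k : ℕ} :
    (a ≤ w.symm k ∧ w.symm k ≤ b) ↔ (a ≤ k ∧ k ≤ b) := by
  have := SB_mem hw (k := w.symm k)
  simp only [Equiv.apply_symm_apply] at this
  exact this.symm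

lemma cone_of_Mon {a b : ℕ} {w : Equiv.Perm ℕ} (hw : w ∈ SB a b) {k l : ℕ} (hk : a ≤ k ∧ k ≤ b)
    (hl : a ≤ l ∧ l ≤ b) (h : Mon w k l) : rootR k l ∈ ConeB a b w := by
  have hk' := (SB_symm_mem hw).2 hk
  have hl' := (SB_symm_mem hw).2 hl
  rcases le_total (w.symm k) (w.symm l) with hkl | hkl
  · have := path_asc (a := a) (b := b) (w := w) hk'.1 hkl hl'.2 (fun i => (h i).1)
    simpa using this
  · have := path_desc (a := a) (b := b) (w := w) hl'.1 hkl hk'.2 (fun i => (h i).2)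
    simpa using this

/-- prefix sums -/
noncomputable def PS (a : ℕ) (w : Equiv.Perm ℕ) (i : ℕ) : (ℕ → ℝ) →ₗ[ℝ] ℝ where
  toFun v := ∑ j ∈ Finset.Icc a i, v (w j)
  map_add' x y := by simp [Finset.sum_add_distrib]
  map_smul' r x := by simp [Finset.mul_sum]

lemma PS_root (a : ℕ) (w : Equiv.Perm ℕ) (i k l : ℕ) :
    PS a w i (rootR k l) = (if a ≤ w.symm k ∧ w.symm k ≤ i then 1 else 0) -
      (if a ≤ w.symm l ∧ w.symm l ≤ i then 1 else 0) := by
  simp only [PS, rootR, LinearMap.coe_mk, AddHom.coe_mk, Finset.sum_sub_distrib]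
  simp only [← Equiv.eq_symm_apply, Finset.sum_ite_eq', Finset.mem_Icc]

lemma PS_abs_asc {a r : ℕ} {w : Equiv.Perm ℕ} {i : ℕ} (har : a ≤ r) 
    (h : w i < w (i + 1)) : 0 ≤ PS a w i (absRoot w r) := by
  by_cases hri : r = i
  · subst hri
    rw [absRoot, min_eq_left h.le, max_eq_right h.le, PS_root]
    simp [har]
  · rcases le_total (w r) (w (r + 1)) with h1 | h1
    · rw [absRoot, min_eq_left h1, max_eq_right h1, PS_root]
      simp only [Equiv.symm_apply_apply]
      split_ifs <;> first | omega | norm_num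
    · rw [absRoot, min_eq_right h1, max_eq_left h1, PS_root]
      simp only [Equiv.symm_apply_apply]
      split_ifs <;> first | omega | norm_num

lemma PS_abs_desc {a r : ℕ} {w : Equiv.Perm ℕ} {i : ℕ} (har : a ≤ r) 
    (h : w (i + 1) < w i) : PS a w i (absRoot w r) ≤ 0 := by
  by_cases hri : r = i
  · subst hri
    rw [absRoot, min_eq_right h.le, max_eq_left h.le, PS_root]
    simp [har]
  · rcases le_total (w r) (w (r + 1)) with h1 | h1
    · rw [absRoot, min_eq_left h1, max_eq_right h1, PS_root]
      simp only [Equiv.symm_apply_apply]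
      split_ifs <;> first | omega | norm_num
    · rw [absRoot, min_eq_right h1, max_eq_left h1, PS_root]
      simp only [Equiv.symm_apply_apply]
      split_ifs <;> first | omega | norm_num

lemma PS_cone_asc {a b : ℕ} {w : Equiv.Perm ℕ} {i : ℕ} {v : ℕ → ℝ} (hv : v ∈ ConeB a b w)
    (h : w i < w (i + 1)) : 0 ≤ PS a w i v := by
  obtain ⟨c, hc, rfl⟩ := hv
  rw [map_sum]
  refine Finset.sum_nonneg fun r hr => ?_
  rw [map_smul]
  exact mul_nonneg (hc r hr) (PS_abs_asc (Finset.mem_Icc.1 hr).1 h)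

lemma PS_cone_desc {a b : ℕ} {w : Equiv.Perm ℕ} {i : ℕ} {v : ℕ → ℝ} (hv : v ∈ ConeB a b w)
    (h : w (i + 1) < w i) : PS a w i v ≤ 0 := by
  obtain ⟨c, hc, rfl⟩ := hv
  rw [map_sum]
  refine Finset.sum_nonpos fun r hr => ?_
  rw [map_smul]
  exact mul_nonpos_of_nonneg_of_nonpos (hc r hr) (PS_abs_desc (Finset.mem_Icc.1 hr).1 h)

lemma eps_lemma {x y : ℝ} (h : ∀ ε : ℝ, 0 < ε → 0 ≤ x + ε * y) : 0 ≤ x := by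
  by_contra hx
  push Not at hx
  have hd : 0 < |y| + 1 := by positivity
  have h1 := h (-x / (2 * (|y| + 1))) (by apply div_pos <;> linarith)
  have h2 : -x / (2 * (|y| + 1)) * y ≤ -x / 2 := by
    rw [div_mul_eq_mul_div, div_le_div_iff₀ (by linarith) (by norm_num)]
    nlinarith [le_abs_self y]
  linarith

lemma Mon_of_cone {a b : ℕ} {w : Equiv.Perm ℕ} (hw : w ∈ SB a b) {k l : ℕ} (hk : a ≤ k ∧ k ≤ b)
    (hl : a ≤ l ∧ l ≤ b) (z : ℕ → ℝ)
    (h : ∀ ε : ℝ, 0 < ε → rootR k l + ε • z ∈ ConeB a b w) : Mon w k l := by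
  have hk' := (SB_symm_mem hw).2 hk
  have hl' := (SB_symm_mem hw).2 hl
  intro i
  have hne : w i ≠ w (i + 1) := fun h => by have := w.injective h; omega
  constructor
  · intro h1 h2
    by_contra hc
    have hd : w (i + 1) < w i := by omega
    have : 0 ≤ - PS a w i (rootR k l) := by
      apply eps_lemma (y := - PS a w i z)
      intro ε hε
      have := PS_cone_desc (h ε hε) hd
      rw [map_add, map_smul, smul_eq_mul] at this
      linarith
    rw [PS_root, if_pos ⟨hk'.1, h1⟩, if_neg (by omega)] at this
    norm_num at this
  · intro h1 h2
    by_contra hc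
    have hd : w i < w (i + 1) := by omega
    have : 0 ≤ PS a w i (rootR k l) := by
      apply eps_lemma (y := PS a w i z)
      intro ε hε
      have := PS_cone_asc (h ε hε) hd
      rwa [map_add, map_smul, smul_eq_mul] at this
    rw [PS_root, if_neg (by omega), if_pos ⟨hl'.1, h1⟩] at this
    norm_num at this

lemma sum_Ico_root {s t : ℕ} (h : s ≤ t) :
    ∑ i ∈ Finset.Ico s t, rootR i (i + 1) = rootR s t := by
  induction t, h using Nat.le_induction with
  | base => simp [rootR_self]
  | succ t ht ih => rw [Finset.sum_Ico_succ_top ht, ih, rootR_add]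

lemma sum_ind {a b s t : ℕ} (h1 : a ≤ s) (h2 : s ≤ t) (h3 : t ≤ b) (ε : ℝ) (z : ℕ → ℝ) :
    ∑ i ∈ Finset.Icc a (b - 1), ((if s ≤ i ∧ i < t then (1 : ℝ) else 0) + ε * z i) • rootR i (i + 1)
      = rootR s t + ε • ∑ i ∈ Finset.Icc a (b - 1), z i • rootR i (i + 1) := by
  simp only [add_smul, Finset.sum_add_distrib, mul_smul, Finset.smul_sum]
  congr 1
  rw [← sum_Ico_root h2]
  simp only [ite_smul, one_smul, zero_smul]
  rw [← Finset.sum_filter]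
  congr 1
  ext i
  simp only [Finset.mem_filter, Finset.mem_Icc, Finset.mem_Ico]
  omega

lemma abel_dec (a q : ℕ) (h : a ≤ q) (c : ℕ → ℝ) :
    ∑ i ∈ Finset.Ico a q, c i • rootR i (i + 1) =
      ∑ k ∈ Finset.Ico a q, (c k - c (k + 1)) • rootR a (k + 1) + c q • rootR a q := by
  induction q, h using Nat.le_induction with
  | base => simp [rootR_self]
  | succ q hq ih =>
    rw [Finset.sum_Ico_succ_top hq, Finset.sum_Ico_succ_top hq, ih, ← rootR_add a q (q + 1)]
    module

lemma abel_inc (q r b : ℕ) (h : q ≤ r) (c : ℕ → ℝ) :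
    ∑ i ∈ Finset.Ico q (r + 1), c i • rootR i (i + 1) =
      ∑ k ∈ Finset.Ico q r, (c (k + 1) - c k) • rootR (k + 1) b + c q • rootR q b
       - c r • rootR (r + 1) b := by
  induction r, h using Nat.le_induction with
  | base => simp [← rootR_add q (q + 1) b]
  | succ r hr ih =>
    rw [Finset.sum_Ico_succ_top (show q ≤ r + 1 by omega), ih, Finset.sum_Ico_succ_top hr,
      ← rootR_add (r + 1) (r + 1 + 1) b]
    module

lemma Icc_Ico (a b : ℕ) (h : 1 ≤ b) : Finset.Icc a (b - 1) = Finset.Ico a b := by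
  ext i; simp; omega

lemma Wdec_iff {a b : ℕ} (hab : a < b) (w : Equiv.Perm ℕ) :
    w ∈ Wdec a b ↔ w ∈ SB a b ∧ ∀ k, a ≤ k → k ≤ b → Mon w a k := by
  constructor
  · rintro ⟨hw, h⟩
    refine ⟨hw, fun k h1 h2 => ?_⟩
    apply Mon_of_cone hw ⟨le_refl _, hab.le⟩ ⟨h1, h2⟩
      (∑ i ∈ Finset.Icc a (b - 1), ((b : ℝ) - i) • rootR i (i + 1))
    intro ε hε
    apply h
    refine ⟨_, ?_, ?_, (sum_ind (le_refl a) h1 h2 ε _).symm⟩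
    · intro i _ _
      push_cast
      split_ifs <;> first | omega | nlinarith
    · have : ((b - 1 : ℕ) : ℝ) = b - 1 := by rw [Nat.cast_sub (by omega)]; simp
      rw [this]
      split_ifs <;> nlinarith
  · rintro ⟨hw, h⟩
    refine ⟨hw, ?_⟩
    rintro v ⟨c, hc, hc0, rfl⟩
    rw [Icc_Ico a b (by omega)]
    obtain ⟨b, rfl⟩ : ∃ b', b = b' + 1 := ⟨b - 1, by omega⟩
    rw [Finset.sum_Ico_succ_top (by omega), abel_dec a b (by omega) c, add_assoc, ← smul_add, 
      rootR_add]
    have hm : ∀ k, a ≤ k → k ≤ b + 1 → rootR a k ∈ ConeB a (b + 1) w := fun k h1 h2 =>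
      cone_of_Mon hw ⟨le_refl _, hab.le⟩ ⟨h1, h2⟩ (h k h1 h2)
    refine cone_add (cone_sum _ _ fun i hi => ?_) (cone_smul hc0.le (hm _ (by omega) (by omega)))
    rw [Finset.mem_Ico] at hi
    exact cone_smul (by linarith [hc i hi.1 (by omega)]) (hm _ (by omega) (by omega))

lemma Winc_iff {a b : ℕ} (hab : a < b) (w : Equiv.Perm ℕ) :
    w ∈ Winc a b ↔ w ∈ SB a b ∧ ∀ k, a ≤ k → k ≤ b → Mon w k b := by
  constructor
  · rintro ⟨hw, h⟩
    refine ⟨hw, fun k h1 h2 => ?_⟩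
    apply Mon_of_cone hw ⟨h1, h2⟩ ⟨hab.le, le_refl _⟩ 
      (∑ i ∈ Finset.Icc a (b - 1), ((i : ℝ) + 1) • rootR i (i + 1))
    intro ε hε
    apply h
    refine ⟨_, ?_, ?_, (sum_ind h1 h2 (le_refl b) ε _).symm⟩
    · split_ifs <;> positivity
    · intro i _ _
      push_cast
      split_ifs <;> first | omega | nlinarith
  · rintro ⟨hw, h⟩
    refine ⟨hw, ?_⟩
    rintro v ⟨c, hc0, hc, rfl⟩
    rw [Icc_Ico a b (by omega)]
    obtain ⟨b, rfl⟩ : ∃ b', b = b' + 1 := ⟨b - 1, by omega⟩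
    rw [abel_inc a b (b + 1) (by omega) c, rootR_self, smul_zero, sub_zero]
    have hm : ∀ k, a ≤ k → k ≤ b + 1 → rootR k (b + 1) ∈ ConeB a (b + 1) w := fun k h1 h2 =>
      cone_of_Mon hw ⟨h1, h2⟩ ⟨hab.le, le_refl _⟩ (h k h1 h2)
    refine cone_add (cone_sum _ _ fun i hi => ?_) (cone_smul hc0.le (hm _ (by omega) (by omega)))
    rw [Finset.mem_Ico] at hi
    exact cone_smul (by linarith [hc i hi.1 (by omega)]) (hm _ (by omega) (by omega))

lemma Wm_iff {n m p : ℕ} (hp : p = n - m) (hp1 : 1 < p) (hpn : p < n) (w : Equiv.Perm ℕ) :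
    w ∈ Wm n m ↔ w ∈ SB 1 n ∧ (∀ k, 1 ≤ k → k ≤ p → Mon w 1 k) ∧ 
      (∀ k, p + 1 ≤ k → k ≤ n → Mon w k n) ∧ Mon w 1 n := by
  subst hp
  set p := n - m with hp
  have main : ∀ s t, 1 ≤ s → s ≤ t → t ≤ n → (s = 1 ∨ p < s) → (t = n ∨ t ≤ p) → 
      w ∈ Wm n m → Mon w s t := by
    rintro s t h1 h2 h3 h4 h5 ⟨hw, h⟩
    apply Mon_of_cone hw ⟨h1, by omega⟩ ⟨by omega, h3⟩ 
      (∑ i ∈ Finset.Icc 1 (n - 1), ((1 : ℝ) + |(i : ℝ) - p|) • rootR i (i + 1))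
    intro ε hε
    apply h
    refine ⟨_, ?_, ?_, ?_, (sum_ind h1 h2 h3 ε _).symm⟩
    · intro i hi1 hi2
      have : (i : ℝ) + 1 ≤ p := by exact_mod_cast hi2
      push_cast
      rw [abs_of_nonpos (by linarith), abs_of_nonpos (by linarith)]
      split_ifs <;> first | omega | nlinarith
    · intro i hi1 hi2
      have : (p : ℝ) ≤ i := by exact_mod_cast hi1
      push_cast
      rw [abs_of_nonneg (by linarith), abs_of_nonneg (by linarith)]
      split_ifs <;> first | omega | nlinarith
    · split_ifs <;> positivity
  constructor
  · intro h
    refine ⟨h.1, fun k h1 h2 => main _ _ ?_ ?_ ?_ ?_ ?_ h, fun k h1 h2 => main _ _ ?_ ?_ ?_ ?_ ?_ h, 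
      main _ _ ?_ ?_ ?_ ?_ ?_ h⟩ <;> omega
  · rintro ⟨hw, hX, hY, h1n⟩
    refine ⟨hw, ?_⟩
    rintro v ⟨c, hc1, hc2, hc0, rfl⟩
    rw [← hp] at hc1 hc2 hc0
    rw [Icc_Ico 1 n (by omega)]
    obtain ⟨n, rfl⟩ : ∃ b', n = b' + 1 := ⟨n - 1, by omega⟩
    rw [← Finset.sum_Ico_consecutive _ hp1.le hpn.le, abel_inc p n (n + 1) (by omega) c, rootR_self,
      smul_zero, sub_zero, abel_dec 1 p (by omega) c]
    have e : ∀ A B x y : ℕ → ℝ, A + x + (B + y) = (A + B) + (x + y) := fun A B x y => by abel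
    rw [e, ← smul_add, rootR_add]
    refine cone_add (cone_add (cone_sum _ _ fun i hi => ?_) (cone_sum _ _ fun i hi => ?_)) 
      (cone_smul hc0.le (cone_of_Mon hw (by omega) (by omega) h1n))
    · rw [Finset.mem_Ico] at hi
      exact cone_smul (by linarith [hc1 i hi.1 (by omega)]) (cone_of_Mon hw (by omega) (by omega)
        (hX _ (by omega) (by omega)))
    · rw [Finset.mem_Ico] at hi
      exact cone_smul (by linarith [hc2 i hi.1 (by omega)]) (cone_of_Mon hw (by omega) (by omega)
        (hY _ (by omega) (by omega)))

lemma wLong_apply (a b k : ℕ) : wLong a b k = if a ≤ k ∧ k ≤ b then a + b - k else k := rfl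

lemma wLong_symm (a b : ℕ) : (wLong a b).symm = wLong a b := rfl

lemma wLong_sq (a b : ℕ) : wLong a b * wLong a b = 1 := by
  ext k
  have := (wLong a b).symm_apply_apply k
  rw [wLong_symm] at this
  simpa using this

lemma SB_rev {n : ℕ} {w : Equiv.Perm ℕ} (hw : w ∈ SB 1 n) : w * wLong 1 n ∈ SB 1 n := by
  intro k hk
  have h2 : ¬ (1 ≤ k ∧ k ≤ n) := by simpa using hk
  rw [Equiv.Perm.mul_apply, wLong_apply, if_neg h2]
  exact hw k hk

lemma Mon_rev {n : ℕ} {w : Equiv.Perm ℕ} (hw : w ∈ SB 1 n) {k l : ℕ} (hk : 1 ≤ k ∧ k ≤ n)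
    (hl : 1 ≤ l ∧ l ≤ n) (h : Mon w k l) : Mon (w * wLong 1 n) k l := by
  have hk' := (SB_symm_mem hw).2 hk
  have hl' := (SB_symm_mem hw).2 hl
  have e1 : (w * wLong 1 n).symm k = 1 + n - w.symm k := by
    change wLong 1 n (w.symm k) = _
    rw [wLong_apply, if_pos hk']
  have e2 : (w * wLong 1 n).symm l = 1 + n - w.symm l := by
    change wLong 1 n (w.symm l) = _
    rw [wLong_apply, if_pos hl']
  intro i
  rw [e1, e2, Equiv.Perm.mul_apply, Equiv.Perm.mul_apply]
  constructor <;> intro h1 h2 <;> 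
    rw [wLong_apply, wLong_apply, if_pos (by omega), if_pos (by omega)] <;>
    have h3 := h (n - i) <;>
    rw [show 1 + n - (i + 1) = n - i by omega, show 1 + n - i = n - i + 1 by omega]
  · exact h3.2 (by omega) (by omega)
  · exact h3.1 (by omega) (by omega)

lemma Wm_rev {n m : ℕ} (hp1 : 1 < n - m) (hpn : n - m < n) {w : Equiv.Perm ℕ} (hw : w ∈ Wm n m) :
    w * wLong 1 n ∈ Wm n m := by
  rw [Wm_iff rfl hp1 hpn] at hw ⊢
  obtain ⟨h0, h1, h2, h3⟩ := hw
  exact ⟨SB_rev h0, fun k a b => Mon_rev h0 (by omega) (by omega) (h1 k a b), 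
    fun k a b => Mon_rev h0 (by omega) (by omega) (h2 k a b), Mon_rev h0 (by omega) (by omega) h3⟩

lemma asc_lt {w : Equiv.Perm ℕ} {s t : ℕ} (hst : s < t) :
    (∀ i, s ≤ i → i < t → w i < w (i + 1)) → w s < w t := by
  induction t, hst using Nat.le_induction with
  | base => intro h; exact h s (by omega) (by omega)
  | succ t hst ih =>
    intro h
    exact (ih fun i h1 h2 => h i h1 (by omega)).trans (h t (by omega) (by omega))

lemma E_sub {n m : ℕ} (hp1 : 1 < n - m) (hpn : n - m + 1 < n) {u v : Equiv.Perm ℕ}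
    (hu : u ∈ Wdec 1 (n - m)) (hv : v ∈ Winc (n - m + 1) n) : u * v ∈ Wm n m := by
  rw [Wm_iff rfl hp1 (by omega)]
  rw [Wdec_iff hp1] at hu
  rw [Winc_iff hpn] at hv
  generalize n - m = p at *
  obtain ⟨hu, hum⟩ := hu
  obtain ⟨hv, hvm⟩ := hv
  have u0 : ∀ k, ¬ (1 ≤ k ∧ k ≤ p) → u k = k := fun k hk => hu k (by simpa using hk)
  have v0 : ∀ k, ¬ (p + 1 ≤ k ∧ k ≤ n) → v k = k := fun k hk => hv k (by rwa [Finset.mem_Icc])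
  have lo : ∀ i, i ≤ p → (u * v) i = u i := fun i hi => by
    rw [Equiv.Perm.mul_apply, v0 i (by omega)]
  have hi : ∀ i, p < i → (u * v) i = v i := fun i hi => by
    rw [Equiv.Perm.mul_apply]
    apply u0
    by_cases h : i ≤ n
    · have := (SB_mem hv (k := i)).2 ⟨hi, h⟩
      omega
    · rw [v0 i (by omega)]; omega
  have slo : ∀ k, 1 ≤ k → k ≤ p → (u * v).symm k = u.symm k := fun k h1 h2 => by
    rw [Equiv.symm_apply_eq, lo _ ((SB_symm_mem hu).2 ⟨h1, h2⟩).2, Equiv.apply_symm_apply]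
  have shi : ∀ k, p + 1 ≤ k → k ≤ n → (u * v).symm k = v.symm k := fun k h1 h2 => by
    rw [Equiv.symm_apply_eq, hi _ ((SB_symm_mem hv).2 ⟨h1, h2⟩).1, Equiv.apply_symm_apply]
  refine ⟨?_, ?_, ?_, ?_⟩
  · intro k hk
    rw [Finset.mem_Icc] at hk
    rw [Equiv.Perm.mul_apply, v0 k (by omega), u0 k (by omega)]
  · intro k h1 h2 i
    have a1 := ((SB_symm_mem hu).2 ⟨h1, h2⟩)
    have a2 := ((SB_symm_mem hu (k := 1)).2 (by omega))
    rw [slo k h1 h2, slo 1 (by omega) (by omega)]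
    have := hum k h1 h2 i
    constructor <;> intro h3 h4 <;> rw [lo _ (by omega), lo _ (by omega)]
    · exact this.1 h3 h4
    · exact this.2 h3 h4
  · intro k h1 h2 i
    have a1 := ((SB_symm_mem hv).2 ⟨h1, h2⟩)
    have a2 := ((SB_symm_mem hv (k := n)).2 (by omega))
    rw [shi k h1 h2, shi n (by omega) (by omega)]
    have := hvm k h1 h2 i
    constructor <;> intro h3 h4 <;> rw [hi _ (by omega), hi _ (by omega)]
    · exact this.1 h3 h4
    · exact this.2 h3 h4
  · intro i
    have a1 := ((SB_symm_mem hu (k := 1)).2 (by omega))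
    have a2 := ((SB_symm_mem hv (k := n)).2 (by omega))
    rw [slo 1 (by omega) (by omega), shi n (by omega) (by omega)]
    constructor <;> intro h3 h4
    · have b1 := (SB_mem hu (k := p)).2 (by omega)
      have b2 := (SB_mem hv (k := p + 1)).2 (by omega)
      rcases lt_trichotomy i p with h | h | h
      · rw [lo _ (by omega), lo _ (by omega)]
        refine (hum (u p) b1.1 b1.2 i).1 h3 ?_
        rwa [Equiv.symm_apply_apply]
      · subst h
        rw [lo _ (by omega), hi _ (by omega)]
        omega
      · rw [hi _ (by omega), hi _ (by omega)]
        refine (hvm (v (p + 1)) b2.1 b2.2 i).1 ?_ h4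
        rwa [Equiv.symm_apply_apply]
    · omega

lemma Wm_sub {n m : ℕ} (hp1 : 1 < n - m) (hpn : n - m + 1 < n) {w : Equiv.Perm ℕ}
    (hw : w ∈ Wm n m) (hpos : w.symm 1 < w.symm n) : 
    ∃ u ∈ Wdec 1 (n - m), ∃ v ∈ Winc (n - m + 1) n, u * v = w := by
  rw [Wm_iff rfl hp1 (by omega)] at hw
  simp only [Wdec_iff hp1, Winc_iff hpn]
  generalize n - m = p at *
  obtain ⟨hw, hX, hY, h1n⟩ := hw
  have w0 : ∀ k, ¬ (1 ≤ k ∧ k ≤ n) → w k = k := fun k hk => hw k (by rwa [Finset.mem_Icc])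
  have pm : ∀ k, 1 ≤ k → k ≤ n → 1 ≤ w.symm k ∧ w.symm k ≤ n := fun k h1 h2 => 
    (SB_symm_mem hw).2 ⟨h1, h2⟩
  have p1 := pm 1 (by omega) (by omega)
  have pn := pm n (by omega) (by omega)
  have inj : ∀ k l, w.symm k = w.symm l → k = l := fun k l h => w.symm.injective h
  have Y1 : ∀ j, p + 1 ≤ j → j ≤ n → w.symm 1 < w.symm j := by
    intro j h1 h2
    by_contra hc
    have hne : w.symm 1 ≠ w.symm j := fun h => by have := inj _ _ h; omega
    have hj := pm j (by omega) h2
    have := (hY j h1 h2 (w.symm 1 - 1)).1 (by omega) (by omega)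
    rw [show w.symm 1 - 1 + 1 = w.symm 1 by omega, Equiv.apply_symm_apply] at this
    have := (SB_mem hw (k := w.symm 1 - 1)).2 (by omega)
    omega
  have Xn : ∀ k, 1 ≤ k → k ≤ p → w.symm k < w.symm n := by
    intro k h1 h2
    by_contra hc
    have hne : w.symm n ≠ w.symm k := fun h => by have := inj _ _ h; omega
    have hk := pm k h1 (by omega)
    have := (hX k h1 h2 (w.symm n)).1 (by omega) (by omega)
    rw [Equiv.apply_symm_apply] at this
    have := (SB_mem hw (k := w.symm n + 1)).2 (by omega)
    omega
  have XY : ∀ k j, 1 ≤ k → k ≤ p → p + 1 ≤ j → j ≤ n → w.symm k < w.symm j := by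
    intro k j h1 h2 h3 h4
    by_contra hc
    have hne : w.symm j ≠ w.symm k := fun h => by have := inj _ _ h; omega
    have a1 := Y1 j h3 h4
    have a2 := Xn k h1 h2
    have := asc_lt (w := w) (s := w.symm j) (t := w.symm k) (by omega) 
      (fun i b1 b2 => (h1n i).1 (by omega) (by omega))
    simp only [Equiv.apply_symm_apply] at this
    omega
  have inv1 : ∀ i, i ≤ p → w i ≤ p := by
    intro i hi
    by_contra hc
    have hi1 : 1 ≤ i := by
      by_contra h
      rw [w0 i (by omega)] at hc
      omega
    have := (SB_mem hw (k := i)).2 (by omega)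
    have hc2 : (Finset.Icc 1 p).card ≤ (Finset.Icc 1 (i - 1)).card := by
      apply Finset.card_le_card_of_injOn w.symm
      · intro k hk
        simp only [Finset.coe_Icc, Set.mem_Icc] at hk ⊢
        have h1 := XY k (w i) hk.1 hk.2 (by omega) (by omega)
        rw [Equiv.symm_apply_apply] at h1
        have := pm k hk.1 (by omega)
        omega
      · exact w.symm.injective.injOn
    simp at hc2
    omega
  have inv2 : ∀ i, p < i → p < w i := by
    intro i hi
    by_contra hc
    have hi1 : i ≤ n := by
      by_contra h
      rw [w0 i (by omega)] at hc
      omega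
    have := (SB_mem hw (k := i)).2 (by omega)
    have hc2 : (Finset.Icc (p + 1) n).card ≤ (Finset.Icc (i + 1) n).card := by
      apply Finset.card_le_card_of_injOn w.symm
      · intro k hk
        simp only [Finset.coe_Icc, Set.mem_Icc] at hk ⊢
        have h1 := XY (w i) k (by omega) (by omega) hk.1 hk.2
        rw [Equiv.symm_apply_apply] at h1
        have := pm k (by omega) (by omega)
        omega
      · exact w.symm.injective.injOn
    simp at hc2
    omega
  have inv : ∀ i, w i ≤ p ↔ i ≤ p := fun i => by
    constructor
    · intro h
      by_contra hc
      have := inv2 i (by omega)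
      omega
    · exact inv1 i
  let u : Equiv.Perm ℕ := Equiv.Perm.ofSubtype (w.subtypePerm (p := fun i => i ≤ p) inv)
  have ulo : ∀ i, i ≤ p → u i = w i := fun i hi => by
    simp only [u]
    exact Equiv.Perm.ofSubtype_apply_of_mem (p := fun i => i ≤ p) (w.subtypePerm inv) hi
  have uhi : ∀ i, p < i → u i = i := fun i hi => 
    Equiv.Perm.ofSubtype_apply_of_not_mem _ (by simpa using hi)
  have uslo : ∀ i, i ≤ p → u.symm i = w.symm i := fun i hi => by
    rw [Equiv.symm_apply_eq, ulo, Equiv.apply_symm_apply]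
    rw [← inv, Equiv.apply_symm_apply]; exact hi
  have ushi : ∀ i, p < i → u.symm i = i := fun i hi => by
    rw [Equiv.symm_apply_eq, uhi i hi]
  have vlo : ∀ i, i ≤ p → (u⁻¹ * w) i = i := fun i hi => by
    change u.symm (w i) = i
    rw [Equiv.symm_apply_eq, ulo i hi]
  have vhi : ∀ i, p < i → (u⁻¹ * w) i = w i := fun i hi => ushi _ (inv2 i hi)
  have vshi : ∀ i, p < i → (u⁻¹ * w).symm i = w.symm i := fun i hi => by
    change w.symm (u i) = w.symm i
    rw [uhi i hi]
  have plo : ∀ i, i ≤ p → w.symm i ≤ p := fun i hi => by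
    rw [← inv, Equiv.apply_symm_apply]; exact hi
  have phi : ∀ i, p < i → p < w.symm i := fun i hi => by
    by_contra hc
    have := inv1 (w.symm i) (by omega)
    rw [Equiv.apply_symm_apply] at this
    omega
  refine ⟨u, ⟨?_, ?_⟩, u⁻¹ * w, ⟨?_, ?_⟩, by group⟩
  · intro k hk
    rw [Finset.mem_Icc] at hk
    by_cases h : k ≤ p
    · rw [ulo k h, w0 k (by omega)]
    · exact uhi k (by omega)
  · intro k h1 h2 i
    rw [uslo k h2, uslo 1 (by omega)]
    have a1 := plo k h2
    have a2 := plo 1 (by omega)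
    constructor <;> intro h3 h4 <;> rw [ulo _ (by omega), ulo _ (by omega)]
    · exact (hX k h1 h2 i).1 h3 h4
    · exact (hX k h1 h2 i).2 h3 h4
  · intro k hk
    rw [Finset.mem_Icc] at hk
    by_cases h : k ≤ p
    · exact vlo k h
    · rw [vhi k (by omega), w0 k (by omega)]
  · intro k h1 h2 i
    rw [vshi k (by omega), vshi n (by omega)]
    have a1 := phi k (by omega)
    have a2 := phi n (by omega)
    constructor <;> intro h3 h4 <;> rw [vhi _ (by omega), vhi _ (by omega)]
    · exact (hY k h1 h2 i).1 h3 h4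
    · exact (hY k h1 h2 i).2 h3 h4

theorem Wm_inductive_description (n m : ℕ) (hn : 4 ≤ n) (hm1 : 1 < m) (hm2 : m < n - 1) :
    Wm n m =
      Set.image2 (fun u v => u * v) (Wdec 1 (n - m)) (Winc (n - m + 1) n) ∪
        (fun x => x * wLong 1 n) ''
          Set.image2 (fun u v => u * v) (Wdec 1 (n - m)) (Winc (n - m + 1) n) := by
  have hp1 : 1 < n - m := by omega
  have hpn : n - m + 1 < n := by omega
  ext w
  constructor
  · intro hw
    have hne : w.symm 1 ≠ w.symm n := fun h => by have := w.symm.injective h; omega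
    rcases lt_or_gt_of_ne hne with h | h
    · left
      obtain ⟨u, hu, v, hv, e⟩ := Wm_sub hp1 hpn hw h
      exact ⟨u, hu, v, hv, e⟩
    · right
      have a1 := (SB_symm_mem hw.1 (k := 1)).2 (by omega)
      have a2 := (SB_symm_mem hw.1 (k := n)).2 (by omega)
      have h' : (w * wLong 1 n).symm 1 < (w * wLong 1 n).symm n := by
        change wLong 1 n (w.symm 1) < wLong 1 n (w.symm n)
        rw [wLong_apply, wLong_apply, if_pos a1, if_pos a2]
        omega
      obtain ⟨u, hu, v, hv, e⟩ := Wm_sub hp1 hpn (Wm_rev hp1 (by omega) hw) h'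
      refine ⟨u * v, ⟨u, hu, v, hv, rfl⟩, ?_⟩
      change u * v * wLong 1 n = w
      rw [e, mul_assoc, wLong_sq, mul_one]
  · rintro (⟨u, hu, v, hv, rfl⟩ | ⟨_, ⟨u, hu, v, hv, rfl⟩, rfl⟩)
    · exact E_sub hp1 hpn hu hv
    · exact Wm_rev hp1 (by omega) (E_sub hp1 hpn hu hv)
end
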